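/- Let σx = [[0,1],[1,0]] and σz = [[1,0],[0,−1]] be the Pauli matrices over ℂ, let Φ = (1/2)·[[1,0,0,1],[0,0,0,0],[0,0,0,0],[1,0,0,1]] be the projector onto the state (|00⟩+|11⟩)/√2, and for v ∈ ℝ let W(v) = v·Φ + (1−v)·I₄/4 (2-qubit Werner state). Define A_x = (σz + (−1)^x σx)/√2 for x ∈ {0,1}, B₀ = σz ⊗ σz and B₁ = σx ⊗ σx (Kronecker products). Then for all v₁, v₂ ∈ ℝ and all x¹, x², x³ ∈ {0,1}, the trace of the 16×16 matrix (W(v₁) ⊗ W(v₂)) · (A_{x¹} ⊗ B_{x²} ⊗ A_{x³}) equals (−1)^{x¹x² + x²x³} · v₁v₂/2. -/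

import Mathlib

open Matrix Kronecker

namespace Stmt14

noncomputable section

/-- The Pauli matrix `σx`. -/
def σx : Matrix (Fin 2) (Fin 2) ℂ := !![0, 1; 1, 0]

/-- The Pauli matrix `σz`. -/
def σz : Matrix (Fin 2) (Fin 2) ℂ := !![1, 0; 0, -1]

/-- The projector `Φ = (1/2)·[[1,0,0,1],[0,0,0,0],[0,0,0,0],[1,0,0,1]]` onto
`(|00⟩+|11⟩)/√2`, with the four basis states indexed by `Fin 2 × Fin 2`. -/
def Φ : Matrix (Fin 2 × Fin 2) (Fin 2 × Fin 2) ℂ :=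
  Matrix.of fun p q => if p.1 = p.2 ∧ q.1 = q.2 then (1/2 : ℂ) else 0

/-- The two-qubit Werner state `W(v) = v·Φ + (1−v)·I₄/4`. -/
def W (v : ℝ) : Matrix (Fin 2 × Fin 2) (Fin 2 × Fin 2) ℂ :=
  (v : ℂ) • Φ + ((1 - v : ℝ) : ℂ) • ((4 : ℂ)⁻¹ • (1 : Matrix (Fin 2 × Fin 2) (Fin 2 × Fin 2) ℂ))

/-- The measurement `A_x = (σz + (−1)^x σx)/√2` for `x ∈ {0,1}`. -/
def A (x : Fin 2) : Matrix (Fin 2) (Fin 2) ℂ :=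
  ((Real.sqrt 2 : ℂ))⁻¹ • (σz + ((-1 : ℂ) ^ (x : ℕ)) • σx)

/-- The measurement `B₀ = σz ⊗ σz`, `B₁ = σx ⊗ σx` (Kronecker products). -/
def B (x : Fin 2) : Matrix (Fin 2 × Fin 2) (Fin 2 × Fin 2) ℂ :=
  if x = 0 then σz ⊗ₖ σz else σx ⊗ₖ σx

/-- The canonical identification of the 16-dimensional index sets
`((q1 q2),(q3 q4)) ≃ (q1,(q2,(q3,q4)))` (associativity of the Kronecker product). -/
def eL : (Fin 2 × Fin 2) × (Fin 2 × Fin 2) ≃ Fin 2 × Fin 2 × Fin 2 × Fin 2 :=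
  Equiv.prodAssoc (Fin 2) (Fin 2) (Fin 2 × Fin 2)

/-- The canonical identification `(q1,((q2 q3),q4)) ≃ (q1,(q2,(q3,q4)))`. -/
def eR : Fin 2 × (Fin 2 × Fin 2) × Fin 2 ≃ Fin 2 × Fin 2 × Fin 2 × Fin 2 :=
  (Equiv.refl (Fin 2)).prodCongr (Equiv.prodAssoc (Fin 2) (Fin 2) (Fin 2))

theorem reindex_kronecker_chain (P Q R S : Matrix (Fin 2) (Fin 2) ℂ) :
    Matrix.reindex eR eR (P ⊗ₖ ((Q ⊗ₖ R) ⊗ₖ S)) = Matrix.reindex eL eL ((P ⊗ₖ Q) ⊗ₖ (R ⊗ₖ S)) := by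
  ext ⟨a, b, c, d⟩ ⟨a', b', c', d'⟩
  simp [eL, eR, Matrix.kroneckerMap_apply, mul_assoc]

theorem trace_reindex_mul_reindex {m n : Type*} [Fintype m] [Fintype n] (e : m ≃ n)
    (M N : Matrix m m ℂ) :
    Matrix.trace (Matrix.reindex e e M * Matrix.reindex e e N) = Matrix.trace (M * N) := by
  simp only [Matrix.reindex_apply, Matrix.submatrix_mul_equiv]
  exact e.symm.sum_comp fun i => (M * N) i i

theorem trace_Φ_mul_kronecker (P Q : Matrix (Fin 2) (Fin 2) ℂ) :
    Matrix.trace (Φ * (P ⊗ₖ Q)) = Matrix.trace (P * Qᵀ) / 2 := by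
  simp [Φ, Matrix.trace, Matrix.mul_apply, Fintype.sum_prod_type, Matrix.kroneckerMap_apply]
  ring

theorem trace_W_mul_kronecker (v : ℝ) (P Q : Matrix (Fin 2) (Fin 2) ℂ) :
    Matrix.trace (W v * (P ⊗ₖ Q))
      = v * (Matrix.trace (P * Qᵀ) / 2) + (1 - v) / 4 * (P.trace * Q.trace) := by
  simp only [W, add_mul, smul_mul_assoc, one_mul, Matrix.trace_add, Matrix.trace_smul,
    trace_Φ_mul_kronecker, Matrix.trace_kronecker, smul_eq_mul]
  push_cast
  ring

/-- The Pauli matrix whose square Kronecker product is `B x`. -/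
def pauli (x : Fin 2) : Matrix (Fin 2) (Fin 2) ℂ := if x = 0 then σz else σx

theorem B_eq_kronecker_pauli (x : Fin 2) : B x = pauli x ⊗ₖ pauli x := by
  unfold B pauli
  split_ifs <;> rfl

theorem trace_pauli (x : Fin 2) : (pauli x).trace = 0 := by
  fin_cases x <;> simp [pauli, σz, σx, Matrix.trace_fin_two]

theorem transpose_pauli (x : Fin 2) : (pauli x)ᵀ = pauli x := by
  ext i j
  fin_cases x <;> fin_cases i <;> fin_cases j <;> simp [pauli, σz, σx]

theorem trace_A_mul_pauli (x y : Fin 2) :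
    Matrix.trace (A x * pauli y) = 2 * ((√2 : ℝ) : ℂ)⁻¹ * (-1) ^ ((x : ℕ) * (y : ℕ)) := by
  fin_cases x <;> fin_cases y <;>
    simp [A, pauli, σz, σx, Matrix.trace_fin_two] <;> ring

theorem trace_W_mul_A_kronecker_pauli (v : ℝ) (x y : Fin 2) :
    Matrix.trace (W v * (A x ⊗ₖ pauli y))
      = v * ((√2 : ℝ) : ℂ)⁻¹ * (-1) ^ ((x : ℕ) * (y : ℕ)) := by
  rw [trace_W_mul_kronecker, trace_pauli, transpose_pauli, trace_A_mul_pauli]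
  ring

theorem transpose_A (x : Fin 2) : (A x)ᵀ = A x := by
  ext i j
  fin_cases i <;> fin_cases j <;> simp [A, σz, σx]

theorem trace_W_mul_pauli_kronecker_A (v : ℝ) (x y : Fin 2) :
    Matrix.trace (W v * (pauli y ⊗ₖ A x))
      = v * ((√2 : ℝ) : ℂ)⁻¹ * (-1) ^ ((y : ℕ) * (x : ℕ)) := by
  rw [trace_W_mul_kronecker, trace_pauli, transpose_A, Matrix.trace_mul_comm, trace_A_mul_pauli,
    mul_comm (y : ℕ)]
  ring

/-- For all `v₁, v₂ ∈ ℝ` and all `x1, x2, x3 ∈ {0,1}`, the trace of the 16×16 matrix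
`(W(v₁) ⊗ W(v₂)) · (A_{x1} ⊗ B_{x2} ⊗ A_{x3})` equals `(−1)^{x1x2 + x2x3} · v₁v₂/2`. -/
theorem trace_werner_chain (v₁ v₂ : ℝ) (x1 x2 x3 : Fin 2) :
    Matrix.trace
      ((Matrix.reindex eL eL (W v₁ ⊗ₖ W v₂))
        * (Matrix.reindex eR eR (A x1 ⊗ₖ (B x2 ⊗ₖ A x3))))
      = ((-1 : ℂ) ^ ((x1 : ℕ) * (x2 : ℕ) + (x2 : ℕ) * (x3 : ℕ)))
          * ((v₁ * v₂ / 2 : ℝ) : ℂ) := by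
  have hsqrt : ((√2 : ℝ) : ℂ)⁻¹ * ((√2 : ℝ) : ℂ)⁻¹ = 2⁻¹ := by
    rw [← mul_inv, ← Complex.ofReal_mul, Real.mul_self_sqrt zero_le_two, Complex.ofReal_ofNat]
  rw [B_eq_kronecker_pauli, reindex_kronecker_chain, trace_reindex_mul_reindex,
    ← Matrix.mul_kronecker_mul, Matrix.trace_kronecker, trace_W_mul_A_kronecker_pauli,
    trace_W_mul_pauli_kronecker_A, pow_add]
  push_cast
  linear_combination
    v₁ * v₂ * (-1) ^ ((x1 : ℕ) * (x2 : ℕ)) * (-1) ^ ((x2 : ℕ) * (x3 : ℕ)) * hsqrt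

end

end Stmt14
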